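/- Let d ≥ 1 and n_1,…,n_d, r_1,…,r_d be positive integers, and let S_r = {X ∈ ℝ^{n_1×⋯×n_d} : X has HOSVD-rank at most (r_1,…,r_d) and ‖X‖_F = 1}. Then for every ε with 0 < ε < 1 there exists a finite set N of tensors in ℝ^{n_1×⋯×n_d} with cardinality |N| ≤ (3(d+1)/ε)^{r_1·r_2·⋯·r_d + Σ_{i=1}^d n_i·r_i} such that for every X ∈ S_r there exists X̄ ∈ N with ‖X − X̄‖_F ≤ ε. -/

import Mathlib

open scoped BigOperators

noncomputable section

/-- Frobenius norm of a tensor given as a real-valued function on a finite index set. -/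
def frob {ι : Type*} [Fintype ι] (X : ι → ℝ) : ℝ :=
  Real.sqrt (∑ j, X j ^ 2)

/-- The mode-`k` unfolding of an order-`d` tensor, with columns indexed (redundantly)
by full multi-indices: entry `(a, j)` is `X` evaluated at `j` with its `k`-th index
replaced by `a`.  Its rank coincides with the rank of the usual mode-`k` unfolding. -/
def unfold {d : ℕ} (n : Fin d → ℕ) (k : Fin d) (X : (∀ i, Fin (n i)) → ℝ) :
    Matrix (Fin (n k)) (∀ i, Fin (n i)) ℝ :=
  Matrix.of fun a j => X (Function.update j k a)

/-- `X` has HOSVD-rank at most `r`: every mode-`k` unfolding has matrix rank at most `r k`. -/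
def hosvdRankLE {d : ℕ} (n r : Fin d → ℕ) (X : (∀ i, Fin (n i)) → ℝ) : Prop :=
  ∀ k, (unfold n k X).rank ≤ r k

open Metric Module in
/-- The closed unit ball of a finite-dimensional normed space has a `δ`-net of cardinality at most
`(3 / δ) ^ dim`. -/
theorem exists_finset_net_closedBall {E : Type*} [NormedAddCommGroup E] [NormedSpace ℝ E]
    [FiniteDimensional ℝ E] {δ : ℝ} (hδ0 : 0 < δ) (hδ1 : δ ≤ 1) :
    ∃ N : Finset E, (N.card : ℝ) ≤ (3 / δ) ^ finrank ℝ E ∧ (∀ y ∈ N, ‖y‖ ≤ 1) ∧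
      ∀ x : E, ‖x‖ ≤ 1 → ∃ y ∈ N, ‖x - y‖ ≤ δ := by
  classical
  have sep_card : ∀ s : Finset E, (∀ c ∈ s, ‖c‖ ≤ 1) →
      (∀ c ∈ s, ∀ e ∈ s, c ≠ e → δ ≤ ‖c - e‖) → (s.card : ℝ) ≤ (3 / δ) ^ finrank ℝ E := by
    intro s hs h
    borelize E
    let μ : MeasureTheory.Measure E := MeasureTheory.Measure.addHaar
    have hδ2 : 0 < δ / 2 := by positivity
    have hρ : 0 < 1 + δ / 2 := by positivity
    have D : Set.Pairwise (s : Set E) (Function.onFun Disjoint fun c => ball (c : E) (δ / 2)) := by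
      rintro c hc e he hce
      apply ball_disjoint_ball
      rw [dist_eq_norm]
      linarith [h c hc e he hce]
    have A_subset : (⋃ c ∈ s, ball (c : E) (δ / 2)) ⊆ ball (0 : E) (1 + δ / 2) := by
      refine Set.iUnion₂_subset fun x hx => ball_subset_ball' ?_
      rw [dist_zero_right]
      linarith [hs x hx]
    have I : (s.card : ENNReal) * ENNReal.ofReal ((δ / 2) ^ finrank ℝ E) * μ (ball 0 1) ≤
        ENNReal.ofReal ((1 + δ / 2) ^ finrank ℝ E) * μ (ball 0 1) :=
      calc
        _ = μ (⋃ c ∈ s, ball (c : E) (δ / 2)) := by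
          rw [MeasureTheory.measure_biUnion_finset D fun c _ => measurableSet_ball]
          simp only [μ.addHaar_ball_of_pos _ hδ2, Finset.sum_const, nsmul_eq_mul, mul_assoc]
        _ ≤ μ (ball (0 : E) (1 + δ / 2)) := MeasureTheory.measure_mono A_subset
        _ = _ := by simp only [μ.addHaar_ball_of_pos _ hρ]
    have J := (ENNReal.mul_le_mul_iff_left (measure_ball_pos μ (0 : E) zero_lt_one).ne'
      MeasureTheory.measure_ball_lt_top.ne).1 I
    have K := ENNReal.toReal_le_of_le_ofReal (pow_nonneg hρ.le _) J
    rw [ENNReal.toReal_mul, ENNReal.toReal_natCast, ENNReal.toReal_ofReal (by positivity)] at K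
    calc (s.card : ℝ) ≤ (1 + δ / 2) ^ finrank ℝ E / (δ / 2) ^ finrank ℝ E := by
          rwa [le_div_iff₀ (by positivity)]
      _ = ((1 + δ / 2) / (δ / 2)) ^ finrank ℝ E := by rw [div_pow _ (δ / 2)]
      _ ≤ _ := by
          refine pow_le_pow_left₀ (by positivity) ?_ _
          rw [div_le_div_iff₀ hδ2 hδ0]
          nlinarith
  let Q : ℕ → Prop := fun k => ∃ s : Finset E, s.card = k ∧ (∀ c ∈ s, ‖c‖ ≤ 1) ∧
    ∀ c ∈ s, ∀ e ∈ s, c ≠ e → δ ≤ ‖c - e‖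
  obtain ⟨s, hcard, hs, hsep⟩ : Q (Nat.findGreatest Q ⌊(3 / δ) ^ finrank ℝ E⌋₊) :=
    Nat.findGreatest_spec (P := Q) (Nat.zero_le _) ⟨∅, by simp⟩
  refine ⟨s, sep_card s hs hsep, hs, fun x hx => ?_⟩
  by_contra! hfar
  have hxs : x ∉ s := fun hxs => by
    have := hfar x hxs
    rw [sub_self, norm_zero] at this
    linarith
  have hball : ∀ c ∈ insert x s, ‖c‖ ≤ 1 := by
    simpa [hx] using hs
  have hsep' : ∀ c ∈ insert x s, ∀ e ∈ insert x s, c ≠ e → δ ≤ ‖c - e‖ := by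
    intro c hc e he hce
    rcases Finset.mem_insert.1 hc with rfl | hcs <;> rcases Finset.mem_insert.1 he with rfl | hes
    · exact absurd rfl hce
    · exact (hfar e hes).le
    · rw [norm_sub_rev]
      exact (hfar c hcs).le
    · exact hsep c hcs e hes hce
  have := Nat.le_findGreatest (P := Q) (Nat.le_floor (sep_card _ hball hsep'))
    ⟨_, rfl, hball, hsep'⟩
  rw [Finset.card_insert_of_notMem hxs] at this
  omega

section Tucker
open scoped Matrix Matrix.Norms.L2Operator
open Matrix

variable {ι : Type*} [Fintype ι] {l m n : ι → Type*}

theorem prod_update_apply_apply [DecidableEq ι] (A : ∀ k, Matrix (l k) (m k) ℝ) (k : ι)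
    (z : Matrix (l k) (m k) ℝ) (i : ∀ k, l k) (j : ∀ k, m k) :
    ∏ t, (Function.update A k z) t (i t) (j t) =
      z (i k) (j k) * ∏ t ∈ Finset.univ.erase k, A t (i t) (j t) := by
  rw [← Finset.mul_prod_erase _ _ (Finset.mem_univ k), Function.update_self]
  congr 1
  refine Finset.prod_congr rfl fun t ht => ?_
  rw [Function.update_of_ne (Finset.ne_of_mem_erase ht)]

/-- The Kronecker product of a finite family of matrices, multilinear in the family. -/
def piKronecker (l m : ι → Type*) :
    MultilinearMap ℝ (fun k => Matrix (l k) (m k) ℝ) (Matrix (∀ k, l k) (∀ k, m k) ℝ) where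
  toFun A := Matrix.of fun i j => ∏ k, A k (i k) (j k)
  map_update_add' A k x y := by
    ext i j
    simp only [Matrix.of_apply, Matrix.add_apply, prod_update_apply_apply, add_mul]
  map_update_smul' A k c x := by
    ext i j
    simp only [Matrix.of_apply, Matrix.smul_apply, prod_update_apply_apply, smul_eq_mul, mul_assoc]

theorem piKronecker_apply (A : ∀ k, Matrix (l k) (m k) ℝ) (i : ∀ k, l k) (j : ∀ k, m k) :
    piKronecker l m A i j = ∏ k, A k (i k) (j k) := rfl

theorem piKronecker_mul [DecidableEq ι] [∀ k, Fintype (m k)]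
    (A : ∀ k, Matrix (l k) (m k) ℝ) (B : ∀ k, Matrix (m k) (n k) ℝ) :
    piKronecker l n (fun k => A k * B k) = piKronecker l m A * piKronecker m n B := by
  ext i j
  simp only [piKronecker_apply, Matrix.mul_apply, Fintype.prod_sum, Finset.prod_mul_distrib]

theorem piKronecker_transpose (A : ∀ k, Matrix (l k) (m k) ℝ) :
    piKronecker m l (fun k => (A k)ᵀ) = (piKronecker l m A)ᵀ := rfl

theorem piKronecker_diagonal [∀ k, DecidableEq (m k)] (v : ∀ k, m k → ℝ) :
    piKronecker m m (fun k => diagonal (v k)) = diagonal (fun i => ∏ k, v k (i k)) := by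
  ext i j
  rw [piKronecker_apply]
  by_cases h : i = j
  · subst h
    simp
  · obtain ⟨k, hk⟩ := Function.ne_iff.1 h
    rw [diagonal_apply_ne _ h]
    exact Finset.prod_eq_zero (Finset.mem_univ k) (diagonal_apply_ne _ hk)

theorem piKronecker_one [∀ k, DecidableEq (m k)] :
    piKronecker m m (fun _ => 1) = 1 := by
  simpa using piKronecker_diagonal (m := m) (fun _ _ => 1)

theorem l2_opNorm_one_le {n : Type*} [Fintype n] [DecidableEq n] :
    ‖(1 : Matrix n n ℝ)‖ ≤ 1 := by
  rw [← diagonal_one, l2_opNorm_diagonal]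
  exact (pi_norm_le_iff_of_nonneg zero_le_one).2 fun _ => by simp

theorem l2_opNorm_le_one_of_transpose_mul_self {m n : Type*} [Fintype m] [Fintype n]
    [DecidableEq m] [DecidableEq n] {A : Matrix m n ℝ} (h : Aᵀ * A = 1) : ‖A‖ ≤ 1 := by
  have h1 := l2_opNorm_conjTranspose_mul_self A
  rw [conjTranspose_eq_transpose_of_trivial, h] at h1
  nlinarith [l2_opNorm_one_le (n := n), norm_nonneg A]

theorem l2_opNorm_transpose {m n : Type*} [Fintype m] [Fintype n]
    [DecidableEq m] [DecidableEq n] (A : Matrix m n ℝ) : ‖Aᵀ‖ = ‖A‖ := by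
  rw [← conjTranspose_eq_transpose_of_trivial, l2_opNorm_conjTranspose]

theorem l2_opNorm_conj_le {n p : Type*} [Fintype n] [DecidableEq n] [Fintype p] [DecidableEq p]
    {R : Matrix n p ℝ} (hR : ‖R‖ ≤ 1) (D : Matrix p p ℝ) : ‖R * D * Rᵀ‖ ≤ ‖D‖ := by
  have hRD : ‖R * D‖ ≤ ‖D‖ :=
    (l2_opNorm_mul _ _).trans (mul_le_of_le_one_left (norm_nonneg _) hR)
  refine (l2_opNorm_mul _ _).trans ?_
  rw [l2_opNorm_transpose]
  exact (mul_le_of_le_one_right (norm_nonneg _) hR).trans hRD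

/-- The spectral norm of a Kronecker product is at most the product of the spectral norms. -/
theorem norm_piKronecker_le [DecidableEq ι] [∀ k, Fintype (l k)] [∀ k, DecidableEq (l k)]
    [∀ k, Fintype (m k)] [∀ k, DecidableEq (m k)] (A : ∀ k, Matrix (l k) (m k) ℝ) :
    ‖piKronecker l m A‖ ≤ ∏ k, ‖A k‖ := by
  have hsym : ∀ k, ((A k)ᵀ * A k).IsHermitian := fun k => by
    simpa using isHermitian_conjTranspose_mul_self (A k)
  choose Q v hQ hQ' hA using fun k => show ∃ (Q : Matrix (m k) (m k) ℝ) (v : m k → ℝ),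
      Qᵀ * Q = 1 ∧ Q * Qᵀ = 1 ∧ (A k)ᵀ * A k = Q * diagonal v * Qᵀ by
    refine ⟨(hsym k).eigenvectorUnitary, (hsym k).eigenvalues, ?_, ?_, ?_⟩
    · exact Unitary.coe_star_mul_self (hsym k).eigenvectorUnitary
    · exact Unitary.coe_mul_star_self (hsym k).eigenvectorUnitary
    · exact (hsym k).spectral_theorem
  have hv : ∀ k, ‖v k‖ ≤ ‖A k‖ ^ 2 := fun k => by
    have hd : diagonal (v k) = (Q k)ᵀ * ((A k)ᵀ * A k) * Q k := by
      rw [hA k]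
      simp only [Matrix.mul_assoc, hQ k, Matrix.mul_one]
      rw [← Matrix.mul_assoc, hQ k, Matrix.one_mul]
    have hQ1 : ‖(Q k)ᵀ‖ ≤ 1 := by
      rw [l2_opNorm_transpose]
      exact l2_opNorm_le_one_of_transpose_mul_self (hQ k)
    have h2 := l2_opNorm_conjTranspose_mul_self (A k)
    rw [conjTranspose_eq_transpose_of_trivial] at h2
    rw [← l2_opNorm_diagonal, hd, sq, ← h2]
    simpa using l2_opNorm_conj_le hQ1 ((A k)ᵀ * A k)
  have hKQ : ‖piKronecker m m Q‖ ≤ 1 := by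
    refine l2_opNorm_le_one_of_transpose_mul_self ?_
    rw [← piKronecker_transpose, ← piKronecker_mul]
    simp only [hQ, piKronecker_one]
  have hK : (piKronecker l m A)ᵀ * piKronecker l m A =
      piKronecker m m Q * diagonal (fun i => ∏ k, v k (i k)) * (piKronecker m m Q)ᵀ := by
    rw [← piKronecker_transpose, ← piKronecker_transpose, ← piKronecker_diagonal,
      ← piKronecker_mul, ← piKronecker_mul, ← piKronecker_mul]
    simp only [hA]
  have hD : ‖fun i : ∀ k, m k => ∏ k, v k (i k)‖ ≤ (∏ k, ‖A k‖) ^ 2 := by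
    refine (pi_norm_le_iff_of_nonneg (by positivity)).2 fun i => ?_
    rw [norm_prod, ← Finset.prod_pow]
    exact Finset.prod_le_prod (fun _ _ => norm_nonneg _) fun k _ =>
      (norm_le_pi_norm (v k) (i k)).trans (hv k)
  have h2 := l2_opNorm_conjTranspose_mul_self (piKronecker l m A)
  rw [conjTranspose_eq_transpose_of_trivial, hK] at h2
  refine abs_le_of_sq_le_sq' ?_ (Finset.prod_nonneg fun _ _ => norm_nonneg _) |>.2
  rw [sq ‖_‖, ← h2]
  refine (l2_opNorm_conj_le hKQ _).trans ?_
  rwa [l2_opNorm_diagonal]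

theorem norm_piKronecker_sub_le [DecidableEq ι] [∀ k, Fintype (l k)] [∀ k, DecidableEq (l k)]
    [∀ k, Fintype (m k)] [∀ k, DecidableEq (m k)] {A B : ∀ k, Matrix (l k) (m k) ℝ} {δ : ℝ}
    (hA : ∀ k, ‖A k‖ ≤ 1) (hB : ∀ k, ‖B k‖ ≤ 1) (hAB : ∀ k, ‖A k - B k‖ ≤ δ) :
    ‖piKronecker l m A - piKronecker l m B‖ ≤ Fintype.card ι * δ := by
  refine ((piKronecker l m).norm_image_sub_le_of_bound' zero_le_one
    (fun C => by simpa using norm_piKronecker_le C) A B).trans ?_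
  rw [one_mul, ← nsmul_eq_mul]
  refine Finset.sum_le_card_nsmul _ _ _ fun k _ => ?_
  calc _ ≤ ∏ t, if t = k then δ else 1 := by
        refine Finset.prod_le_prod (fun t _ => ?_) fun t _ => ?_
        · split_ifs <;> positivity
        · split_ifs with h
          · exact h ▸ hAB k
          · exact max_le (hA t) (hB t)
    _ = δ := by simp

/-- A Kronecker product with a single nontrivial factor acts on the corresponding mode. -/
theorem piKronecker_update_one_mulVec [DecidableEq ι] [∀ k, Fintype (m k)] [∀ k, DecidableEq (m k)]
    (k : ι) (P : Matrix (m k) (m k) ℝ) (X : (∀ t, m t) → ℝ) (i : ∀ t, m t) :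
    (piKronecker m m (Function.update (fun _ => 1) k P) *ᵥ X) i =
      ∑ a, P (i k) a * X (Function.update i k a) := by
  rw [mulVec, dotProduct]
  symm
  refine Fintype.sum_of_injective (Function.update i k) (Function.update_injective i k) _ _ ?_ ?_
  · intro j hj
    obtain ⟨t, htk, ht⟩ : ∃ t, t ≠ k ∧ i t ≠ j t := by
      by_contra! h
      refine hj ⟨j k, ?_⟩
      ext t
      by_cases htk : t = k
      · subst htk; simp
      · simp [htk, h t htk]
    rw [piKronecker_apply, Finset.prod_eq_zero (Finset.mem_univ t), zero_mul]
    rw [Function.update_of_ne htk, one_apply_ne ht]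
  · intro a
    rw [piKronecker_apply, Finset.prod_eq_single k]
    · simp
    · intro t _ ht
      simp [ht]
    · simp

/-- Fixing every mode-`k` fibre of `X` by `P k` fixes `X` by the Kronecker product. -/
theorem piKronecker_mulVec_eq_self [DecidableEq ι] [∀ k, Fintype (m k)] [∀ k, DecidableEq (m k)]
    {P : ∀ k, Matrix (m k) (m k) ℝ} {X : (∀ t, m t) → ℝ}
    (h : ∀ k i, ∑ a, P k (i k) a * X (Function.update i k a) = X i) :
    piKronecker m m P *ᵥ X = X := by
  have key : ∀ s : Finset ι, piKronecker m m (fun k => if k ∈ s then P k else 1) *ᵥ X = X := by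
    intro s
    induction s using Finset.induction_on with
    | empty => simp [piKronecker_one]
    | insert k s hk ih =>
      have hfam : (fun t => if t ∈ insert k s then P t else (1 : Matrix (m t) (m t) ℝ)) =
          fun t => (if t ∈ s then P t else 1) *
            Function.update (fun u => (1 : Matrix (m u) (m u) ℝ)) k (P k) t := by
        ext1 t
        by_cases htk : t = k
        · subst htk; simp [hk]
        · simp [htk]
      rw [hfam, piKronecker_mul, ← mulVec_mulVec]
      have : piKronecker m m (Function.update (fun _ => 1) k (P k)) *ᵥ X = X := by
        ext i
        rw [piKronecker_update_one_mulVec, h]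
      rw [this, ih]
  simpa using key Finset.univ

/-- A matrix of rank at most `r` is fixed by `U * Uᵀ` for some contraction `U` with `r` columns. -/
theorem exists_contraction_mul_transpose_mul_eq {n r : ℕ} {κ : Type*} [Fintype κ]
    [DecidableEq κ] (W : Matrix (Fin n) κ ℝ) (hW : W.rank ≤ r) :
    ∃ U : Matrix (Fin n) (Fin r) ℝ, ‖U‖ ≤ 1 ∧ U * Uᵀ * W = W := by
  let S : Submodule ℝ (EuclideanSpace ℝ (Fin n)) :=
    (LinearMap.range W.mulVecLin).map (WithLp.linearEquiv 2 ℝ (Fin n → ℝ)).symm.toLinearMap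
  have hS : Module.finrank ℝ S ≤ r := by
    rw [LinearEquiv.finrank_map_eq]
    exact hW
  let b := stdOrthonormalBasis ℝ S
  let V : Matrix (Fin n) (Fin (Module.finrank ℝ S)) ℝ :=
    Matrix.of fun a j => (b j : EuclideanSpace ℝ (Fin n)) a
  have hV : Vᵀ * V = 1 := by
    ext i j
    have := orthonormal_iff_ite.1 b.orthonormal j i
    rw [Submodule.coe_inner, PiLp.inner_apply] at this
    rw [Matrix.mul_apply, Matrix.one_apply]
    simp only [eq_comm (a := i)]
    rw [← this]
    simp [V]
  have hcol : ∀ c, WithLp.toLp 2 (W.col c) ∈ S := fun c =>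
    ⟨W.col c, ⟨Pi.single c 1, by simp⟩, rfl⟩
  let C : Matrix (Fin (Module.finrank ℝ S)) κ ℝ := Matrix.of fun j c => b.repr ⟨_, hcol c⟩ j
  have hVC : W = V * C := by
    ext a c
    have := congrArg (fun x : S => (x : EuclideanSpace ℝ (Fin n)) a) (b.sum_repr ⟨_, hcol c⟩)
    simp only [Submodule.coe_sum, Submodule.coe_smul, WithLp.ofLp_sum, Finset.sum_apply,
      PiLp.smul_apply, smul_eq_mul] at this
    rw [Matrix.mul_apply]
    simp only [V, C, Matrix.of_apply, mul_comm (((b _ : S) : EuclideanSpace ℝ (Fin n)) a)]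
    rw [this]
    rfl
  let E : Matrix (Fin (Module.finrank ℝ S)) (Fin r) ℝ :=
    (1 : Matrix (Fin r) (Fin r) ℝ).submatrix (Fin.castLE hS) id
  have hE : E * Eᵀ = 1 := by
    simp only [E, transpose_submatrix, transpose_one]
    rw [← submatrix_mul _ _ _ _ _ Function.bijective_id, Matrix.one_mul,
      submatrix_one _ (Fin.castLE_injective hS)]
  refine ⟨V * E, ?_, ?_⟩
  · have hV1 := l2_opNorm_le_one_of_transpose_mul_self hV
    have hE1 : ‖E‖ ≤ 1 := by
      rw [← l2_opNorm_transpose]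
      exact l2_opNorm_le_one_of_transpose_mul_self (by rwa [transpose_transpose])
    exact (l2_opNorm_mul _ _).trans (mul_le_one₀ hV1 (norm_nonneg _) hE1)
  · calc V * E * (V * E)ᵀ * W = V * (E * Eᵀ) * Vᵀ * (V * C) := by
          rw [transpose_mul, ← hVC]; simp only [Matrix.mul_assoc]
      _ = V * (Vᵀ * V) * C := by rw [hE]; simp only [Matrix.mul_assoc, Matrix.mul_one]
      _ = W := by rw [hV, Matrix.mul_one, ← hVC]

end Tucker

section
open scoped Matrix Matrix.Norms.L2Operator

theorem frob_eq_norm {ι : Type*} [Fintype ι] (X : ι → ℝ) : frob X = ‖WithLp.toLp 2 X‖ := by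
  simp [frob, EuclideanSpace.norm_eq]

theorem frob_mulVec_le {ι κ : Type*} [Fintype ι] [Fintype κ] [DecidableEq κ]
    (A : Matrix ι κ ℝ) (X : κ → ℝ) : frob (A *ᵥ X) ≤ ‖A‖ * frob X := by
  rw [frob_eq_norm, frob_eq_norm]
  exact Matrix.l2_opNorm_mulVec A (WithLp.toLp 2 X)

theorem frob_add_le {ι : Type*} [Fintype ι] (X Y : ι → ℝ) : frob (X + Y) ≤ frob X + frob Y := by
  simp only [frob_eq_norm, WithLp.toLp_add]
  exact norm_add_le _ _

theorem frob_nonneg {ι : Type*} [Fintype ι] (X : ι → ℝ) : 0 ≤ frob X := Real.sqrt_nonneg _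

/-- Higher-order singular value decomposition with contractive factors. -/
theorem hosvdRankLE.exists_eq_piKronecker_mulVec {d : ℕ} {n r : Fin d → ℕ}
    {X : (∀ i, Fin (n i)) → ℝ} (hX : hosvdRankLE n r X) (hX1 : frob X ≤ 1) :
    ∃ (U : ∀ k, Matrix (Fin (n k)) (Fin (r k)) ℝ) (G : (∀ i, Fin (r i)) → ℝ),
      (∀ k, ‖U k‖ ≤ 1) ∧ frob G ≤ 1 ∧
      piKronecker (fun k => Fin (n k)) (fun k => Fin (r k)) U *ᵥ G = X := by
  choose U hU hUW using fun k => exists_contraction_mul_transpose_mul_eq (unfold n k X) (hX k)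
  have hUt : ∀ k, ‖(U k)ᵀ‖ ≤ 1 := fun k => by rw [l2_opNorm_transpose]; exact hU k
  refine ⟨U, piKronecker (fun k => Fin (r k)) (fun k => Fin (n k)) (fun k => (U k)ᵀ) *ᵥ X,
    hU, ?_, ?_⟩
  · refine (frob_mulVec_le _ _).trans (mul_le_one₀ ?_ (frob_nonneg _) hX1)
    exact (norm_piKronecker_le _).trans
      (Finset.prod_le_one (fun _ _ => norm_nonneg _) fun k _ => hUt k)
  · rw [Matrix.mulVec_mulVec, ← piKronecker_mul]
    refine piKronecker_mulVec_eq_self fun k i => ?_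
    have := congrFun (congrFun (hUW k) (i k)) i
    rw [Matrix.mul_apply] at this
    simpa [unfold] using this

end

open scoped Matrix Matrix.Norms.L2Operator in
theorem covering_number_HOSVD
    (d : ℕ) (hd : 1 ≤ d) (n r : Fin d → ℕ)
    (hn : ∀ i, 0 < n i) (hr : ∀ i, 0 < r i)
    (ε : ℝ) (hε0 : 0 < ε) (hε1 : ε < 1) :
    ∃ N : Finset ((∀ i, Fin (n i)) → ℝ),
      (N.card : ℝ) ≤ (3 * (d + 1) / ε) ^ (∏ i, r i + ∑ i, n i * r i) ∧
      ∀ X : (∀ i, Fin (n i)) → ℝ, hosvdRankLE n r X → frob X = 1 →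
        ∃ Y ∈ N, frob (X - Y) ≤ ε := by
  classical
  have hd1 : (0 : ℝ) < d + 1 := by positivity
  obtain ⟨δ, hδ⟩ : ∃ δ : ℝ, δ = ε / (d + 1) := ⟨_, rfl⟩
  have hδ0 : 0 < δ := hδ ▸ div_pos hε0 hd1
  have hδ1 : δ ≤ 1 := by
    rw [hδ, div_le_one hd1]
    linarith [Nat.cast_nonneg (α := ℝ) d]
  have h3 : 3 * ((d : ℝ) + 1) / ε = 3 / δ := by rw [hδ, div_div_eq_mul_div]
  choose NU hNUcard hNU1 hNU using fun k =>
    exists_finset_net_closedBall (E := Matrix (Fin (n k)) (Fin (r k)) ℝ) hδ0 hδ1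
  obtain ⟨NG, hNGcard, -, hNG⟩ :=
    exists_finset_net_closedBall (E := EuclideanSpace ℝ (∀ k, Fin (r k))) hδ0 hδ1
  let K := piKronecker (fun k => Fin (n k)) (fun k => Fin (r k))
  refine ⟨(NG ×ˢ Fintype.piFinset NU).image fun p => K p.2 *ᵥ (WithLp.ofLp p.1), ?_, ?_⟩
  · calc _ ≤ ((NG ×ˢ Fintype.piFinset NU).card : ℝ) := by exact_mod_cast Finset.card_image_le
      _ = NG.card * ∏ k, ((NU k).card : ℝ) := by
        rw [Finset.card_product, Fintype.card_piFinset]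
        push_cast
        rfl
      _ ≤ (3 / δ) ^ (∏ i, r i) * ∏ k, (3 / δ) ^ (n k * r k) := by
        refine mul_le_mul ?_ ?_ (Finset.prod_nonneg fun _ _ => Nat.cast_nonneg _)
          (pow_nonneg (div_pos three_pos hδ0).le _)
        · have hG : Module.finrank ℝ (EuclideanSpace ℝ (∀ k, Fin (r k))) = ∏ i, r i := by
            rw [finrank_euclideanSpace, Fintype.card_pi]
            simp only [Fintype.card_fin]
          rwa [hG] at hNGcard
        · refine Finset.prod_le_prod (fun _ _ => Nat.cast_nonneg _) fun k _ => ?_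
          have hk : Module.finrank ℝ (Matrix (Fin (n k)) (Fin (r k)) ℝ) = n k * r k := by
            rw [Module.finrank_matrix, Fintype.card_fin, Fintype.card_fin, Module.finrank_self,
              mul_one]
          have := hNUcard k
          rwa [hk] at this
      _ = _ := by rw [Finset.prod_pow_eq_pow_sum, ← pow_add, h3]
  · intro X hX hX1
    obtain ⟨U, G, hU, hG, rfl⟩ := hX.exists_eq_piKronecker_mulVec hX1.le
    choose V hVN hUV using fun k => hNU k (U k) (hU k)
    obtain ⟨H, hHN, hGH⟩ := hNG (WithLp.toLp 2 G) (by rwa [← frob_eq_norm])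
    have hV : ∀ k, ‖V k‖ ≤ 1 := fun k => hNU1 k _ (hVN k)
    refine ⟨_, Finset.mem_image_of_mem _
      (Finset.mk_mem_product hHN (Fintype.mem_piFinset.2 hVN)), ?_⟩
    have hsplit : K U *ᵥ G - K V *ᵥ WithLp.ofLp H =
        (K U - K V) *ᵥ G + K V *ᵥ (G - WithLp.ofLp H) := by
      rw [Matrix.sub_mulVec, Matrix.mulVec_sub]
      abel
    have hKV : ‖K V‖ ≤ 1 := (norm_piKronecker_le V).trans
      (Finset.prod_le_one (fun _ _ => norm_nonneg _) fun k _ => hV k)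
    have hKUV : ‖K U - K V‖ ≤ d * δ := by
      simpa using norm_piKronecker_sub_le hU hV hUV
    have hGH' : frob (G - WithLp.ofLp H) ≤ δ := by
      rw [frob_eq_norm, WithLp.toLp_sub]
      exact hGH
    calc frob (K U *ᵥ G - K V *ᵥ WithLp.ofLp H)
        ≤ frob ((K U - K V) *ᵥ G) + frob (K V *ᵥ (G - WithLp.ofLp H)) :=
          hsplit ▸ frob_add_le _ _
      _ ≤ ‖K U - K V‖ * frob G + ‖K V‖ * frob (G - WithLp.ofLp H) :=
          add_le_add (frob_mulVec_le _ _) (frob_mulVec_le _ _)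
      _ ≤ (d * δ) * 1 + 1 * δ := by
          gcongr <;> exact frob_nonneg _
      _ = ε := by
          rw [hδ]
          field_simp
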